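/- Let α ∈ ℂ_p be transcendental over ℚ_p (i.e., α ∉ Q̄_p). Then: (1) there exists a stacked Cauchy sequence E ⊂ Q̄_p converging to α; (2) the valued fields (ℚ_p(X), ℤ_{p,α}) and (ℚ_p(α), O_{p,α}) are isomorphic via the evaluation map X ↦ α; (3) consequently, the ramification index e(ℤ_{p,α}|ℤ_p) equals e_α, the residue field degree f(ℤ_{p,α}|ℤ_p) equals f_α, and e_α · f_α = ∞. -/

import Mathlib

open Polynomial Filter

noncomputable section

/-- An additive `ℚ`-valued valuation on a field `K` (written additively, with `v 0 = ⊤`). -/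
structure AddVal (K : Type) [Field K] where
  v : K → WithTop ℚ
  v_eq_top_iff : ∀ x : K, v x = ⊤ ↔ x = 0
  v_mul : ∀ x y : K, v (x * y) = v x + v y
  min_le_v_add : ∀ x y : K, min (v x) (v y) ≤ v (x + y)

namespace AddVal

variable {K : Type} [Field K] (w : AddVal K)

/-- A Cauchy sequence with respect to an additive valuation. -/
def IsCauchySeq (s : ℕ → K) : Prop :=
  ∀ γ : ℚ, ∃ N : ℕ, ∀ m ≥ N, ∀ n ≥ N, (γ : WithTop ℚ) < w.v (s m - s n)

/-- Convergence of a sequence to a limit, with respect to an additive valuation. -/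
def TendsToVal (s : ℕ → K) (l : K) : Prop :=
  ∀ γ : ℚ, ∃ N : ℕ, ∀ n ≥ N, (γ : WithTop ℚ) < w.v (s n - l)

/-- A pseudo-convergent sequence: `v (s n - s m) < v (s m - s k)` for `n < m < k`. -/
def IsPseudoConvergent (s : ℕ → K) : Prop :=
  ∀ ⦃n m k : ℕ⦄, n < m → m < k → w.v (s n - s m) < w.v (s m - s k)

/-- A sequence is of transcendental type over a subring (mapped in via `g`) if for every
polynomial `f` over that ring the sequence `v (f (s n))` is eventually constant. -/
def IsTranscendentalTypeOver {R : Type} [CommRing R] (g : R →+* K) (s : ℕ → K) : Prop :=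
  ∀ f : Polynomial R, ∃ N : ℕ, ∀ m ≥ N, ∀ n ≥ N,
    w.v (f.eval₂ g (s m)) = w.v (f.eval₂ g (s n))

/-- A sequence of transcendental type: for every polynomial `f ∈ K[X]`, `v (f (s n))` is
eventually constant. -/
def IsTranscendentalType (s : ℕ → K) : Prop :=
  w.IsTranscendentalTypeOver (RingHom.id K) s

/-- `α` is a pseudo-limit of `s` when `v (s n - α)` is strictly increasing. -/
def IsPseudoLimit (s : ℕ → K) (α : K) : Prop :=
  StrictMono fun n => w.v (s n - α)

/-- The breadth ideal of a pseudo-convergent sequence. -/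
def breadth (s : ℕ → K) : Set K :=
  {x : K | ∀ n : ℕ, w.v (s (n + 1) - s n) < w.v x}

/-- Equivalence of pseudo-convergent sequences. -/
def SeqEquiv (s t : ℕ → K) : Prop :=
  w.breadth s = w.breadth t ∧
    ∀ k : ℕ, ∃ i₀ j₀ : ℕ, ∀ i ≥ i₀, ∀ j ≥ j₀, w.v (s (k + 1) - s k) < w.v (s i - t j)

end AddVal

/-- `α` is transcendental over the image of `g`. -/
def IsTranscOver {R K : Type} [CommRing R] [Field K] (g : R →+* K) (α : K) : Prop :=
  ∀ f : Polynomial R, f ≠ 0 → f.eval₂ g α ≠ 0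
/-- A fixed algebraic closure of `ℚ_p`. -/
abbrev Qpbar (p : ℕ) [Fact p.Prime] : Type := AlgebraicClosure ℚ_[p]

/-- The unique extension of the `p`-adic valuation to the algebraic closure of `ℚ_p`,
presented as an additive `ℚ`-valued valuation extending `Padic.valuation`. -/
structure PadicSetup (p : ℕ) [Fact p.Prime] where
  vbar : AddVal (Qpbar p)
  vbar_extends : ∀ x : ℚ_[p], x ≠ 0 →
    vbar.v (algebraMap ℚ_[p] (Qpbar p) x) = ((x.valuation : ℚ) : WithTop ℚ)

/-- A model of `ℂ_p`: a complete valued field in which `Q̄_p` embeds isometrically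
and densely. -/
structure CpSetup (p : ℕ) [Fact p.Prime] extends PadicSetup p where
  Cp : Type
  [fieldCp : Field Cp]
  emb : Qpbar p →+* Cp
  vC : AddVal Cp
  vC_emb : ∀ x : Qpbar p, vC.v (emb x) = vbar.v x
  complete : ∀ s : ℕ → Cp, vC.IsCauchySeq s → ∃ l : Cp, vC.TendsToVal s l
  dense : ∀ y : Cp, ∃ s : ℕ → Qpbar p, vC.TendsToVal (fun n => emb (s n)) y

attribute [instance] CpSetup.fieldCp

variable (p : ℕ) [Fact p.Prime]

/-- The degree `[ℚ_p(x) : ℚ_p]` of an element of the algebraic closure of `ℚ_p`. -/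
def degOf (x : Qpbar p) : ℕ :=
  Module.finrank ℚ_[p] ↥(IntermediateField.adjoin ℚ_[p] {x})

/-- A stacked sequence in `Q̄_p`: `s 0 ∈ ℚ_p`, the degrees `[ℚ_p(s n) : ℚ_p]` are strictly
increasing, and each `(s n, v (s (n+1) - s n))` is a minimal pair. -/
structure IsStacked (S : PadicSetup p) (s : ℕ → Qpbar p) : Prop where
  first : ∃ c : ℚ_[p], s 0 = algebraMap ℚ_[p] (Qpbar p) c
  deg_lt : ∀ n : ℕ, degOf p (s n) < degOf p (s (n + 1))
  min_pair : ∀ n : ℕ, ∀ c : Qpbar p, degOf p c < degOf p (s n) →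
    S.vbar.v (s n - c) < S.vbar.v (s (n + 1) - s n)

/-- A strongly stacked sequence: moreover each pair `(s n, s (n+1))` is distinguished. -/
structure IsStronglyStacked (S : PadicSetup p) (s : ℕ → Qpbar p) extends
    IsStacked p S s : Prop where
  dist : ∀ n : ℕ, ∀ c : Qpbar p, degOf p c < degOf p (s (n + 1)) →
    S.vbar.v (s (n + 1) - c) ≤ S.vbar.v (s (n + 1) - s n)

/-- The canonical map `ℚ → Q̄_p`. -/
def qHomQpbar : ℚ →+* Qpbar p :=
  (algebraMap ℚ_[p] (Qpbar p)).comp (Rat.castHom ℚ_[p])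

/-- The ring `ℤ_{p,E}` (as a subset of `ℚ_p(X)`) attached to a sequence `E ⊆ Q̄_p`:
rational functions mapping almost all the `s n` into `Z̄_p`. -/
def ZpE (S : PadicSetup p) (s : ℕ → Qpbar p) : Set (RatFunc ℚ_[p]) :=
  {φ : RatFunc ℚ_[p] | ∀ᶠ n in atTop,
    φ.denom.eval₂ (algebraMap ℚ_[p] (Qpbar p)) (s n) ≠ 0 ∧
      0 ≤ S.vbar.v (φ.eval (algebraMap ℚ_[p] (Qpbar p)) (s n))}

/-- The ring `ℤ_{(p),E}` (as a subset of `ℚ(X)`) attached to a sequence `E ⊆ Q̄_p`. -/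
def ZplE (S : PadicSetup p) (s : ℕ → Qpbar p) : Set (RatFunc ℚ) :=
  {φ : RatFunc ℚ | ∀ᶠ n in atTop,
    φ.denom.eval₂ (qHomQpbar p) (s n) ≠ 0 ∧
      0 ≤ S.vbar.v (φ.eval (qHomQpbar p) (s n))}

/-- `W` is a residually algebraic torsion extension of `ℤ_p` to `ℚ_p(X)`:
`W ∩ ℚ_p = ℤ_p`, the residue field of `W` is algebraic over `𝔽_p`, and the value group of `W`
is contained in the divisible hull of the value group of `ℤ_p`. -/
def IsResAlgTorsionQp (W : ValuationSubring (RatFunc ℚ_[p])) : Prop :=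
  (∀ c : ℚ_[p], RatFunc.C c ∈ W ↔ ‖c‖ ≤ 1) ∧
  (∀ x : IsLocalRing.ResidueField W, ∃ k : ℕ, 1 ≤ k ∧ x ^ p ^ k = x) ∧
  (∀ φ : RatFunc ℚ_[p], φ ≠ 0 → ∃ n : ℕ, 1 ≤ n ∧ ∃ c : ℚ_[p], c ≠ 0 ∧
    φ ^ n / RatFunc.C c ∈ W ∧ RatFunc.C c / φ ^ n ∈ W)

/-- `W` is a residually algebraic torsion extension of `ℤ_(p)` to `ℚ(X)`. -/
def IsResAlgTorsionQ (W : ValuationSubring (RatFunc ℚ)) : Prop :=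
  (∀ c : ℚ, RatFunc.C c ∈ W ↔ ‖(c : ℚ_[p])‖ ≤ 1) ∧
  (∀ x : IsLocalRing.ResidueField W, ∃ k : ℕ, 1 ≤ k ∧ x ^ p ^ k = x) ∧
  (∀ φ : RatFunc ℚ, φ ≠ 0 → ∃ n : ℕ, 1 ≤ n ∧ ∃ c : ℚ, c ≠ 0 ∧
    φ ^ n / RatFunc.C c ∈ W ∧ RatFunc.C c / φ ^ n ∈ W)

/-- The set of (rational) values of the valuation on an intermediate field of `Q̄_p/ℚ_p`. -/
def valSetF (S : PadicSetup p) (F : IntermediateField ℚ_[p] (Qpbar p)) : Set ℚ :=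
  {γ : ℚ | ∃ a ∈ F, S.vbar.v a = (γ : WithTop ℚ)}

/-- The value group (as a set of rationals) of `ℚ_p(x)` for `x ∈ Q̄_p`. -/
def valSetElem (S : PadicSetup p) (x : Qpbar p) : Set ℚ :=
  valSetF p S (IntermediateField.adjoin ℚ_[p] {x})

/-- The residue field of `F` is contained in the residue field of `F'` (inside the residue
field of `Z̄_p`). -/
def resSub (S : PadicSetup p) (F F' : IntermediateField ℚ_[p] (Qpbar p)) : Prop :=
  ∀ a ∈ F, 0 ≤ S.vbar.v a → ∃ b ∈ F', 0 ≤ S.vbar.v b ∧ 0 < S.vbar.v (a - b)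

/-- A subset `Γ ⊆ ℚ` (a value group) has bounded denominators, i.e. finite ramification
over `ℤ`. -/
def HasFiniteRamification (Γ : Set ℚ) : Prop :=
  ∃ e : ℕ, 0 < e ∧ ∀ γ ∈ Γ, ∃ k : ℤ, (e : ℚ) * γ = (k : ℚ)

/-- The ramification index of `Γ₁` over `Γ₀`: the least positive integer `e` with
`e • Γ₁ ⊆ Γ₀` (for the value groups of finite extensions of `ℚ_p` this is the index
`[Γ₁ : Γ₀]`). -/
def ramIdx (Γ₀ Γ₁ : Set ℚ) : ℕ :=
  sInf {e : ℕ | 0 < e ∧ ∀ γ ∈ Γ₁, (e : ℚ) * γ ∈ Γ₀}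

/-- The value group of `ℚ_p` (normalized): the integers, as a subset of `ℚ`. -/
def zSet : Set ℚ := Set.range ((↑) : ℤ → ℚ)

/-- The maximal unramified extension of a finite extension `K` of `ℚ_p` inside `Q̄_p`:
the set of `x` with `K(x)/K` unramified. -/
def maxUnramified (S : PadicSetup p) (K : IntermediateField ℚ_[p] (Qpbar p)) :
    Set (Qpbar p) :=
  {x : Qpbar p | valSetF p S (K ⊔ IntermediateField.adjoin ℚ_[p] {x}) = valSetF p S K}

section CpDefs

variable (S : CpSetup p)

/-- The canonical map `ℚ_p → ℂ_p`. -/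
def qpHomC : ℚ_[p] →+* S.Cp :=
  S.emb.comp (algebraMap ℚ_[p] (Qpbar p))

/-- The canonical map `ℚ → ℂ_p`. -/
def qHomC : ℚ →+* S.Cp :=
  (qpHomC p S).comp (Rat.castHom ℚ_[p])

/-- The valuation domain `ℤ_{p,α} = {φ ∈ ℚ_p(X) : φ(α) ∈ O_p}` (as a subset of `ℚ_p(X)`). -/
def Zpa (α : S.Cp) : Set (RatFunc ℚ_[p]) :=
  {φ : RatFunc ℚ_[p] | φ.denom.eval₂ (qpHomC p S) α ≠ 0 ∧
    0 ≤ S.vC.v (φ.eval (qpHomC p S) α)}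

/-- The valuation domain `ℤ_{(p),α} = {φ ∈ ℚ(X) : φ(α) ∈ O_p}` (as a subset of `ℚ(X)`). -/
def Zpla (α : S.Cp) : Set (RatFunc ℚ) :=
  {φ : RatFunc ℚ | φ.denom.eval₂ (qHomC p S) α ≠ 0 ∧
    0 ≤ S.vC.v (φ.eval (qHomC p S) α)}

/-- Membership in the subfield `ℚ_p(α)` of `ℂ_p`. -/
def InQpAlpha (α x : S.Cp) : Prop :=
  ∃ f g : Polynomial ℚ_[p], g.eval₂ (qpHomC p S) α ≠ 0 ∧
    x = f.eval₂ (qpHomC p S) α / g.eval₂ (qpHomC p S) α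

/-- The value group `Γ_α ⊆ ℚ` of `ℚ_p(α) ⊆ ℂ_p`. -/
def valSetCp (α : S.Cp) : Set ℚ :=
  {γ : ℚ | ∃ x : S.Cp, InQpAlpha p S α x ∧ S.vC.v x = (γ : WithTop ℚ)}

/-- The residue field `k_α` of `O_{p,α} = O_p ∩ ℚ_p(α)` is finite. -/
def ResFieldFiniteCp (α : S.Cp) : Prop :=
  ∃ T : Finset S.Cp, ∀ x : S.Cp, InQpAlpha p S α x → 0 ≤ S.vC.v x →
    ∃ a ∈ T, 0 < S.vC.v (x - a)

/-- `α` and `β` are conjugate over `ℚ_p`: some element of `Gal(Q̄_p/ℚ_p)`, extended to its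
unique continuous (equivalently, isometric) automorphism of `ℂ_p`, maps `α` to `β`. -/
def ConjCp (α β : S.Cp) : Prop :=
  ∃ σ : S.Cp →+* S.Cp, (∀ c : ℚ_[p], σ (qpHomC p S c) = qpHomC p S c) ∧
    (∀ x : Qpbar p, ∃ y : Qpbar p, σ (S.emb x) = S.emb y) ∧
    (∀ x : S.Cp, S.vC.v (σ x) = S.vC.v x) ∧ σ α = β

end CpDefs

namespace AddVal

variable {K : Type} [Field K]

/-- The bundled Mathlib additive valuation underlying an `AddVal`. -/
def toAddValuation (w : AddVal K) : AddValuation K (WithTop ℚ) :=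
  AddValuation.of w.v ((w.v_eq_top_iff 0).2 rfl)
    (by
      have h := w.v_mul 1 1
      have h1 : w.v 1 ≠ ⊤ := fun h => one_ne_zero ((w.v_eq_top_iff 1).1 h)
      obtain ⟨q, hq⟩ := WithTop.ne_top_iff_exists.1 h1
      rw [mul_one, ← hq] at h
      rw [← hq]
      norm_cast at h ⊢
      linarith)
    w.min_le_v_add w.v_mul

variable (w : AddVal K)

lemma v_zero : w.v 0 = ⊤ := w.toAddValuation.map_zero

lemma v_one : w.v 1 = 0 := w.toAddValuation.map_one

lemma v_neg (x : K) : w.v (-x) = w.v x := w.toAddValuation.map_neg x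

lemma v_sub_swap (x y : K) : w.v (x - y) = w.v (y - x) := w.toAddValuation.map_sub_swap x y

lemma v_pow (x : K) (n : ℕ) : w.v (x ^ n) = n • w.v x := w.toAddValuation.map_pow x n

variable {w}

lemma le_v_add {x y : K} {g : WithTop ℚ} (hx : g ≤ w.v x) (hy : g ≤ w.v y) : g ≤ w.v (x + y) :=
  w.toAddValuation.map_le_add hx hy

lemma lt_v_add {x y : K} {g : WithTop ℚ} (hx : g < w.v x) (hy : g < w.v y) : g < w.v (x + y) :=
  w.toAddValuation.map_lt_add hx hy

lemma le_v_sub {x y : K} {g : WithTop ℚ} (hx : g ≤ w.v x) (hy : g ≤ w.v y) : g ≤ w.v (x - y) :=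
  w.toAddValuation.map_le_sub hx hy

lemma lt_v_sub {x y : K} {g : WithTop ℚ} (hx : g < w.v x) (hy : g < w.v y) : g < w.v (x - y) :=
  sub_eq_add_neg x y ▸ lt_v_add hx ((w.v_neg y).symm ▸ hy)

lemma le_v_sum {ι : Type} {s : Finset ι} {f : ι → K} {g : WithTop ℚ}
    (hf : ∀ i ∈ s, g ≤ w.v (f i)) : g ≤ w.v (∑ i ∈ s, f i) :=
  w.toAddValuation.map_le_sum hf

lemma lt_v_sum {ι : Type} {s : Finset ι} {f : ι → K} {g : WithTop ℚ} (hg : g ≠ ⊤)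
    (hf : ∀ i ∈ s, g < w.v (f i)) : g < w.v (∑ i ∈ s, f i) :=
  w.toAddValuation.map_lt_sum hg hf

lemma v_sub_eq_of_lt_left {x y : K} (h : w.v x < w.v y) : w.v (x - y) = w.v x :=
  w.toAddValuation.map_sub_eq_of_lt_left h

lemma exists_v_eq_coe {x : K} (hx : x ≠ 0) : ∃ q : ℚ, w.v x = q :=
  (WithTop.ne_top_iff_exists.1 (mt (w.v_eq_top_iff x).1 hx)).imp fun _ h => h.symm

lemma v_inv {x : K} {q : ℚ} (hx : w.v x = q) : w.v x⁻¹ = ((-q : ℚ) : WithTop ℚ) := by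
  have h0 : x ≠ 0 := by
    rintro rfl
    simp [v_zero] at hx
  obtain ⟨r, hr⟩ := exists_v_eq_coe (w := w) (inv_ne_zero h0)
  have h := w.v_mul x x⁻¹
  rw [mul_inv_cancel₀ h0, v_one, hx, hr] at h
  rw [hr]
  norm_cast at h ⊢
  linarith

/-- In a vanishing sum, two distinct nonzero terms have the same valuation. -/
lemma exists_v_eq_of_sum_eq_zero {ι : Type} {s : Finset ι} {f : ι → K}
    (hs : ∑ i ∈ s, f i = 0) {i₀ : ι} (hi₀ : i₀ ∈ s) (h₀ : f i₀ ≠ 0) :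
    ∃ i ∈ s, ∃ j ∈ s, i ≠ j ∧ f i ≠ 0 ∧ w.v (f i) = w.v (f j) := by
  classical
  obtain ⟨i, hi, hmin⟩ := s.exists_min_image (fun i => w.v (f i)) ⟨i₀, hi₀⟩
  have hne : w.v (f i) ≠ ⊤ := fun h =>
    h₀ ((w.v_eq_top_iff _).1 (top_le_iff.1 (h ▸ hmin i₀ hi₀)))
  refine ⟨i, hi, ?_⟩
  by_contra! hcon
  have hfi : f i ≠ 0 := mt (w.v_eq_top_iff _).2 hne
  have hlt : w.v (f i) < w.v (∑ j ∈ s.erase i, f j) := lt_v_sum hne fun j hj =>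
    (hmin j (Finset.mem_of_mem_erase hj)).lt_of_ne
      (hcon j (Finset.mem_of_mem_erase hj) (Finset.ne_of_mem_erase hj).symm hfi)
  rw [← Finset.add_sum_erase s f hi, add_eq_zero_iff_neg_eq] at hs
  rw [← hs, v_neg] at hlt
  exact hlt.false

end AddVal

section Degree

variable {p}

lemma degOf_eq_natDegree_minpoly (x : Qpbar p) :
    degOf p x = (minpoly ℚ_[p] x).natDegree :=
  IntermediateField.adjoin.finrank (Algebra.IsIntegral.isIntegral x)

lemma degOf_pos (x : Qpbar p) : 0 < degOf p x := by
  rw [degOf_eq_natDegree_minpoly]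
  exact minpoly.natDegree_pos (Algebra.IsIntegral.isIntegral x)

lemma degOf_sub_le (x y : Qpbar p) : degOf p (x - y) ≤ degOf p x * degOf p y := by
  have hx := IntermediateField.adjoin.finiteDimensional (K := ℚ_[p])
    (Algebra.IsIntegral.isIntegral x)
  have hy := IntermediateField.adjoin.finiteDimensional (K := ℚ_[p])
    (Algebra.IsIntegral.isIntegral y)
  set E := IntermediateField.adjoin ℚ_[p] {x}
  set F := IntermediateField.adjoin ℚ_[p] {y}
  have hle : IntermediateField.adjoin ℚ_[p] {x - y} ≤ E ⊔ F := by
    rw [IntermediateField.adjoin_simple_le_iff]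
    exact sub_mem ((le_sup_left : E ≤ E ⊔ F) (IntermediateField.mem_adjoin_simple_self _ x))
      ((le_sup_right : F ≤ E ⊔ F) (IntermediateField.mem_adjoin_simple_self _ y))
  exact (LinearMap.finrank_le_finrank_of_injective
    (f := (IntermediateField.inclusion hle).toLinearMap)
    (IntermediateField.inclusion_injective hle)).trans (IntermediateField.finrank_sup_le E F)

lemma degOf_algebraMap (c : ℚ_[p]) : degOf p (algebraMap ℚ_[p] (Qpbar p) c) = 1 := by
  rw [degOf_eq_natDegree_minpoly, minpoly.eq_X_sub_C, natDegree_X_sub_C]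

lemma exists_eq_algebraMap_of_degOf_le_one {x : Qpbar p} (h : degOf p x ≤ 1) :
    ∃ c : ℚ_[p], x = algebraMap ℚ_[p] (Qpbar p) c := by
  have h1 : degOf p x = 1 := le_antisymm h (degOf_pos x)
  obtain ⟨c, hc⟩ := IntermediateField.mem_bot.1
    (IntermediateField.finrank_adjoin_simple_eq_one_iff.1 h1)
  exact ⟨c, hc.symm⟩

/-- Values of elements of degree at most `N` have denominators dividing `N!`. -/
lemma exists_factorial_mul_eq_intCast (S : PadicSetup p) {x : Qpbar p} {N : ℕ}
    (hN : degOf p x ≤ N) {q : ℚ} (hq : S.vbar.v x = q) :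
    ∃ k : ℤ, (N.factorial : ℚ) * q = k := by
  have hx : x ≠ 0 := by
    rintro rfl
    simp [AddVal.v_zero] at hq
  set f := minpoly ℚ_[p] x with hf
  have hint : IsIntegral ℚ_[p] x := Algebra.IsIntegral.isIntegral x
  have hsum : ∑ i ∈ Finset.range (f.natDegree + 1),
      algebraMap ℚ_[p] (Qpbar p) (f.coeff i) * x ^ i = 0 := by
    rw [← eval₂_eq_sum_range]
    exact minpoly.aeval ℚ_[p] x
  obtain ⟨i, hi, j, hj, hij, hi0, hv⟩ := AddVal.exists_v_eq_of_sum_eq_zero (w := S.vbar) hsum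
    (i₀ := f.natDegree) (by simp) (by
      rw [coeff_natDegree, (minpoly.monic hint).leadingCoeff]
      simp [hx])
  have hj0 : algebraMap ℚ_[p] (Qpbar p) (f.coeff j) * x ^ j ≠ 0 := fun h =>
    hi0 ((S.vbar.v_eq_top_iff _).1 (hv.trans ((S.vbar.v_eq_top_iff _).2 h)))
  have key : ∀ i, algebraMap ℚ_[p] (Qpbar p) (f.coeff i) * x ^ i ≠ 0 →
      S.vbar.v (algebraMap ℚ_[p] (Qpbar p) (f.coeff i) * x ^ i) =
        (((f.coeff i).valuation + i * q : ℚ) : WithTop ℚ) := by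
    intro i hi
    rw [S.vbar.v_mul, S.vbar_extends _ (by rintro h; simp [h] at hi), AddVal.v_pow, hq,
      ← WithTop.coe_nsmul, ← WithTop.coe_add, nsmul_eq_mul]
  rw [key i hi0, key j hj0, WithTop.coe_inj] at hv
  have hdeg : f.natDegree ≤ N := by rwa [hf, ← degOf_eq_natDegree_minpoly]
  simp only [Finset.mem_range] at hi hj
  have hpos : 0 < ((j : ℤ) - i).natAbs := by omega
  obtain ⟨m, hm⟩ := Nat.dvd_factorial hpos (show ((j : ℤ) - i).natAbs ≤ N by omega)
  obtain ⟨m', hm'⟩ : ((j : ℤ) - i) ∣ (N.factorial : ℤ) :=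
    Int.natAbs_dvd.1 ⟨m, by exact_mod_cast hm⟩
  refine ⟨m' * ((f.coeff i).valuation - (f.coeff j).valuation), ?_⟩
  have hm'' : (N.factorial : ℚ) = ((j : ℚ) - i) * m' := by exact_mod_cast hm'
  rw [hm'']
  push_cast
  linear_combination (-(m' : ℚ)) * hv

end Degree

section CompletionField

variable {p} (S : CpSetup p)

lemma v_qpHomC {x : ℚ_[p]} (hx : x ≠ 0) :
    S.vC.v (qpHomC p S x) = ((x.valuation : ℚ) : WithTop ℚ) := by
  rw [← S.vbar_extends x hx, ← S.vC_emb]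
  rfl

lemma v_qpHomC_nonneg {x : ℚ_[p]} (hx : ‖x‖ ≤ 1) : 0 ≤ S.vC.v (qpHomC p S x) := by
  rcases eq_or_ne x 0 with rfl | h0
  · simp [AddVal.v_zero]
  · rw [v_qpHomC S h0]
    rw [Padic.norm_le_one_iff_val_nonneg] at hx
    exact_mod_cast hx

lemma exists_lt_v_qpHomC (γ : ℚ) :
    ∃ ε > 0, ∀ x : ℚ_[p], ‖x‖ < ε → (γ : WithTop ℚ) < S.vC.v (qpHomC p S x) := by
  obtain ⟨m, hm⟩ := exists_int_gt γ
  have hp : (1 : ℝ) < p := by exact_mod_cast (Fact.out : p.Prime).one_lt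
  refine ⟨(p : ℝ) ^ (-m), by positivity, fun x hx => ?_⟩
  rcases eq_or_ne x 0 with rfl | h0
  · simp [AddVal.v_zero]
  · rw [v_qpHomC S h0]
    rw [Padic.norm_eq_zpow_neg_valuation h0, zpow_lt_zpow_iff_right₀ hp] at hx
    have : (m : ℚ) < x.valuation := by exact_mod_cast neg_lt_neg_iff.1 hx
    exact_mod_cast hm.trans this

lemma eq_zero_of_forall_lt_v {x : S.Cp} (h : ∀ γ : ℚ, (γ : WithTop ℚ) < S.vC.v x) : x = 0 := by
  by_contra hx
  obtain ⟨q, hq⟩ := AddVal.exists_v_eq_coe (w := S.vC) hx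
  exact (hq ▸ h q).false

/-- An element arbitrarily well approximated by `ℚ_p`-linear combinations of finitely many
vectors, with coefficients in a compact set, is itself such a linear combination. -/
lemma exists_eq_sum_of_forall_approx {ι : Type} [Fintype ι] {C : Set (ι → ℚ_[p])}
    (hC : IsCompact C) (u : ι → S.Cp) (x : S.Cp)
    (h : ∀ n : ℕ, ∃ a ∈ C, (n : WithTop ℚ) < S.vC.v (x - ∑ i, qpHomC p S (a i) * u i)) :
    ∃ a ∈ C, x = ∑ i, qpHomC p S (a i) * u i := by
  choose a haC ha using h
  obtain ⟨b, hbC, φ, hφ, hlim⟩ := hC.tendsto_subseq haC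
  refine ⟨b, hbC, sub_eq_zero.1 (eq_zero_of_forall_lt_v S fun γ => ?_)⟩
  have hterm : ∀ i, ∀ᶠ n in atTop,
      (γ : WithTop ℚ) < S.vC.v (qpHomC p S (a (φ n) i - b i) * u i) := by
    intro i
    rcases eq_or_ne (u i) 0 with hu | hu
    · simp [hu, AddVal.v_zero]
    obtain ⟨q, hq⟩ := AddVal.exists_v_eq_coe (w := S.vC) hu
    obtain ⟨ε, hε, hlt⟩ := exists_lt_v_qpHomC S (γ - q)
    have hi : Tendsto (fun n => a (φ n) i) atTop (nhds (b i)) := (tendsto_pi_nhds.1 hlim) i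
    filter_upwards [Metric.tendsto_nhds.1 hi ε hε] with n hn
    have := hlt _ (by rwa [dist_eq_norm] at hn)
    rw [S.vC.v_mul, hq]
    cases hv : S.vC.v (qpHomC p S (a (φ n) i - b i)) with
    | top => simp
    | coe r =>
      rw [hv] at this
      norm_cast at this ⊢
      linarith
  obtain ⟨m, hm⟩ := exists_nat_gt γ
  obtain ⟨n, hn, hmn⟩ := ((eventually_all.2 hterm).and (eventually_ge_atTop m)).exists
  have hsplit : x - ∑ i, qpHomC p S (b i) * u i =
      (x - ∑ i, qpHomC p S (a (φ n) i) * u i) +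
        ∑ i, qpHomC p S (a (φ n) i - b i) * u i := by
    simp only [map_sub, sub_mul, Finset.sum_sub_distrib]
    ring
  rw [hsplit]
  refine AddVal.lt_v_add (lt_of_lt_of_le ?_ (ha (φ n)).le)
    (AddVal.lt_v_sum WithTop.coe_ne_top fun i _ => hn i)
  have : (m : ℚ) ≤ φ n := by exact_mod_cast hmn.trans (hφ.id_le n)
  exact_mod_cast hm.trans_le this

end CompletionField

section Approximation

variable {p} {S : CpSetup p} {α : S.Cp}

lemma exists_degOf_lt_v_sub (γ : ℚ) : ∃ c : Qpbar p, (γ : WithTop ℚ) < S.vC.v (α - S.emb c) := by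
  obtain ⟨s, hs⟩ := S.dense α
  obtain ⟨N, hN⟩ := hs γ
  exact ⟨s N, AddVal.v_sub_swap S.vC _ _ ▸ hN N le_rfl⟩

/-- Polynomials of bounded degree with a coefficient of norm one take values of bounded
valuation at a transcendental element. -/
lemma exists_v_eval_le (hα : IsTranscOver (qpHomC p S) α) (d : ℕ) :
    ∃ n : ℕ, ∀ a : Fin (d + 1) → ℚ_[p], ‖a‖ = 1 →
      S.vC.v (∑ i, qpHomC p S (a i) * α ^ (i : ℕ)) ≤ n := by
  by_contra! hcon
  obtain ⟨a, ha, hsum⟩ := exists_eq_sum_of_forall_approx S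
    (isCompact_sphere (0 : Fin (d + 1) → ℚ_[p]) 1) (fun i => α ^ (i : ℕ)) 0 (fun n => by
      obtain ⟨a, ha, hlt⟩ := hcon n
      exact ⟨a, by simpa using ha, by rwa [zero_sub, AddVal.v_neg]⟩)
  have ha0 : a ≠ 0 := by
    rintro rfl
    simp at ha
  obtain ⟨i, hi⟩ := Function.ne_iff.1 ha0
  refine hα (∑ j : Fin (d + 1), monomial (j : ℕ) (a j)) (fun h => hi ?_) ?_
  · have := congrArg (fun f => coeff f (i : ℕ)) h
    simpa [finsetSum_coeff, coeff_monomial, Fin.val_inj] using this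
  · rw [eval₂_finsetSum]
    simpa [eval₂_monomial] using hsum.symm

/-- A normalized nonzero polynomial of degree at most `d` vanishing at `c`. -/
lemma exists_normalized_relation {d : ℕ} {c : Qpbar p} (hc : degOf p c ≤ d) :
    ∃ a : Fin (d + 1) → ℚ_[p], ‖a‖ = 1 ∧
      ∑ i, qpHomC p S (a i) * S.emb c ^ (i : ℕ) = 0 := by
  set f := minpoly ℚ_[p] c with hf
  have hint : IsIntegral ℚ_[p] c := Algebra.IsIntegral.isIntegral c
  have hdeg : f.natDegree ≤ d := by rwa [hf, ← degOf_eq_natDegree_minpoly]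
  set b : Fin (d + 1) → ℚ_[p] := fun i => f.coeff i with hb
  have hb0 : b ≠ 0 := by
    intro h
    have := congrFun h ⟨f.natDegree, by omega⟩
    simp [hb, (minpoly.monic hint).leadingCoeff, hf] at this
  obtain ⟨i, -, hi⟩ := Finset.univ.exists_max_image (fun i => ‖b i‖) ⟨0, Finset.mem_univ _⟩
  have hnorm : ‖b‖ = ‖b i‖ := le_antisymm
    ((pi_norm_le_iff_of_nonneg (norm_nonneg _)).2 fun j => hi j (Finset.mem_univ _))
    (norm_le_pi_norm b i)
  refine ⟨(b i)⁻¹ • b, ?_, ?_⟩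
  · rw [norm_smul, norm_inv, hnorm, inv_mul_cancel₀]
    rw [← hnorm]
    exact norm_ne_zero_iff.2 hb0
  · have h0 : ∑ j ∈ Finset.range (d + 1), qpHomC p S (f.coeff j) * S.emb c ^ j = 0 := by
      rw [← eval₂_eq_sum_range' _ (Nat.lt_succ_of_le hdeg)]
      have := congrArg S.emb (minpoly.aeval ℚ_[p] c)
      rwa [map_zero, aeval_def, hom_eval₂] at this
    rw [← Fin.sum_univ_eq_sum_range (fun j => qpHomC p S (f.coeff j) * S.emb c ^ j)] at h0
    simp only [Pi.smul_apply, smul_eq_mul, map_mul, mul_assoc, ← Finset.mul_sum]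
    rw [h0, mul_zero]

/-- Algebraic elements of bounded degree stay away from a transcendental element. -/
lemma exists_v_sub_le (hα : IsTranscOver (qpHomC p S) α) (d : ℕ) :
    ∃ M : ℚ, ∀ c : Qpbar p, degOf p c ≤ d → S.vC.v (α - S.emb c) ≤ M := by
  obtain ⟨n, hn⟩ := exists_v_eval_le hα d
  obtain ⟨β, hβ0, hβ⟩ : ∃ β : ℚ, β ≤ 0 ∧ (β : WithTop ℚ) ≤ S.vC.v α := by
    rcases eq_or_ne α 0 with rfl | h0
    · exact ⟨0, le_rfl, by simp [AddVal.v_zero]⟩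
    · obtain ⟨q, hq⟩ := AddVal.exists_v_eq_coe (w := S.vC) h0
      exact ⟨min q 0, min_le_right _ _, hq ▸ by exact_mod_cast min_le_left _ _⟩
  have hdβ : (d : ℚ) * β ≤ 0 := mul_nonpos_of_nonneg_of_nonpos (by positivity) hβ0
  refine ⟨n - d * β, fun c hc => ?_⟩
  obtain ⟨a, ha, hsum⟩ := exists_normalized_relation (S := S) hc
  by_contra! hlt
  obtain ⟨r, hr, hrlt⟩ : ∃ r : ℚ, (n - d * β : ℚ) < r ∧
      (r : WithTop ℚ) ≤ S.vC.v (α - S.emb c) := by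
    cases hv : S.vC.v (α - S.emb c) with
    | top => exact ⟨n - d * β + 1, by linarith, le_top⟩
    | coe q => exact ⟨q, by rw [hv] at hlt; exact_mod_cast hlt, le_rfl⟩
  have hnn : (0 : ℚ) ≤ n := n.cast_nonneg
  have hc' : (β : WithTop ℚ) ≤ S.vC.v (S.emb c) := by
    rw [← sub_sub_cancel α (S.emb c)]
    refine AddVal.le_v_sub hβ (le_trans ?_ hrlt)
    have : β ≤ r := by linarith
    exact_mod_cast this
  have hpow : ∀ i : ℕ, ((i * β : ℚ) : WithTop ℚ) ≤ S.vC.v (S.emb c ^ i) := by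
    intro i
    rw [AddVal.v_pow, ← nsmul_eq_mul, WithTop.coe_nsmul]
    exact nsmul_le_nsmul_right hc' i
  have hdiff : ∀ i : ℕ, ((r + i * β : ℚ) : WithTop ℚ) ≤ S.vC.v (α ^ i - S.emb c ^ i) := by
    intro i
    induction i with
    | zero => simp [AddVal.v_zero]
    | succ i ih =>
      have : α ^ (i + 1) - S.emb c ^ (i + 1) =
          α * (α ^ i - S.emb c ^ i) + (α - S.emb c) * S.emb c ^ i := by ring
      rw [this]
      refine AddVal.le_v_add ?_ ?_
      · rw [S.vC.v_mul]
        refine le_trans ?_ (add_le_add hβ ih)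
        rw [← WithTop.coe_add, WithTop.coe_le_coe]
        push_cast
        linarith
      · rw [S.vC.v_mul]
        refine le_trans ?_ (add_le_add hrlt (hpow i))
        rw [← WithTop.coe_add, WithTop.coe_le_coe]
        push_cast
        linarith
  have hle := hn a ha
  have hrw : ∑ i, qpHomC p S (a i) * α ^ (i : ℕ) =
      ∑ i, qpHomC p S (a i) * (α ^ (i : ℕ) - S.emb c ^ (i : ℕ)) := by
    simp only [mul_sub, Finset.sum_sub_distrib, hsum, sub_zero]
  rw [hrw] at hle
  have hge : ((r + d * β : ℚ) : WithTop ℚ) ≤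
      S.vC.v (∑ i, qpHomC p S (a i) * (α ^ (i : ℕ) - S.emb c ^ (i : ℕ))) := by
    refine AddVal.le_v_sum fun i _ => ?_
    rw [S.vC.v_mul]
    refine le_trans ?_ (add_le_add
      (v_qpHomC_nonneg S ((norm_le_pi_norm a i).trans ha.le)) (hdiff i))
    rw [zero_add, WithTop.coe_le_coe]
    have : ((i : ℕ) : ℚ) ≤ d := by exact_mod_cast Nat.lt_succ_iff.1 i.2
    nlinarith
  have : (r + d * β : ℚ) ≤ n := by exact_mod_cast hge.trans hle
  linarith

/-- Among algebraic elements of degree at most `d ≥ 1` there is one closest to a given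
transcendental element. -/
lemma exists_best_approx (hα : IsTranscOver (qpHomC p S) α) {d : ℕ} (hd : 1 ≤ d) :
    ∃ s : Qpbar p, degOf p s ≤ d ∧
      ∀ c : Qpbar p, degOf p c ≤ d → S.vC.v (α - S.emb c) ≤ S.vC.v (α - S.emb s) := by
  obtain ⟨M, hM⟩ := exists_v_sub_le hα d
  obtain ⟨t, ht⟩ := exists_degOf_lt_v_sub (α := α) M
  set N := degOf p t * d
  have key : ∀ c : Qpbar p, degOf p c ≤ d → ∃ q : ℚ, S.vC.v (α - S.emb c) = q ∧
      ∃ k : ℤ, (N.factorial : ℚ) * q = k := by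
    intro c hc
    have hne : S.vC.v (α - S.emb c) ≠ ⊤ := ((hM c hc).trans_lt (WithTop.coe_lt_top M)).ne
    obtain ⟨q, hq⟩ := WithTop.ne_top_iff_exists.1 hne
    refine ⟨q, hq.symm, exists_factorial_mul_eq_intCast S.toPadicSetup (x := t - c)
      ((degOf_sub_le t c).trans (Nat.mul_le_mul_left _ hc)) ?_⟩
    rw [hq, ← S.vC_emb, map_sub, ← sub_sub_sub_cancel_left _ _ α]
    exact AddVal.v_sub_eq_of_lt_left ((hM c hc).trans_lt ht)
  have hNpos : (0 : ℚ) < N.factorial := by exact_mod_cast N.factorial_pos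
  let P : ℤ → Prop := fun k => ∃ c : Qpbar p, degOf p c ≤ d ∧
    ∃ q : ℚ, S.vC.v (α - S.emb c) = q ∧ (N.factorial : ℚ) * q = k
  have hne : ∃ k, P k := by
    have h0 : degOf p (algebraMap ℚ_[p] (Qpbar p) 0) ≤ d := (degOf_algebraMap 0).trans_le hd
    obtain ⟨q, hq, k, hk⟩ := key _ h0
    exact ⟨k, _, h0, q, hq, hk⟩
  obtain ⟨b, hb⟩ := exists_int_gt ((N.factorial : ℚ) * M)
  have hbdd : ∀ k, P k → k ≤ b := by
    rintro k ⟨c, hc, q, hq, hk⟩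
    have hqM : q ≤ M := by exact_mod_cast hq ▸ hM c hc
    have : (k : ℚ) ≤ b := hk ▸ (mul_le_mul_of_nonneg_left hqM hNpos.le).trans hb.le
    exact_mod_cast this
  obtain ⟨k, ⟨s, hs, q, hq, hk⟩, hmax⟩ := Int.exists_greatest_of_bdd ⟨b, hbdd⟩ hne
  refine ⟨s, hs, fun c hc => ?_⟩
  obtain ⟨q', hq', k', hk'⟩ := key c hc
  have hkk : (k' : ℚ) ≤ k := by exact_mod_cast hmax k' ⟨c, hc, q', hq', hk'⟩
  rw [hq, hq', WithTop.coe_le_coe]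
  rw [← hk, ← hk'] at hkk
  exact le_of_mul_le_mul_left hkk hNpos

/-- `s` is a best approximation of `α` among elements of degree at most that of `s`, strictly
better than any element of smaller degree. -/
def IsBestApprox (α : S.Cp) (s : Qpbar p) : Prop :=
  (∀ c : Qpbar p, degOf p c ≤ degOf p s → S.vC.v (α - S.emb c) ≤ S.vC.v (α - S.emb s)) ∧
  ∀ c : Qpbar p, degOf p c < degOf p s → S.vC.v (α - S.emb c) < S.vC.v (α - S.emb s)

lemma exists_isBestApprox_degOf_eq_one (hα : IsTranscOver (qpHomC p S) α) :
    ∃ s : Qpbar p, degOf p s = 1 ∧ IsBestApprox α s := by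
  obtain ⟨s, hs, hmax⟩ := exists_best_approx hα le_rfl
  have h1 : degOf p s = 1 := le_antisymm hs (degOf_pos s)
  refine ⟨s, h1, fun c hc => hmax c (hc.trans hs), fun c hc => ?_⟩
  have := degOf_pos c
  omega

lemma sub_emb_ne_zero (hα : IsTranscOver (qpHomC p S) α) (c : Qpbar p) : α - S.emb c ≠ 0 := by
  intro h
  refine hα (minpoly ℚ_[p] c) (minpoly.ne_zero (Algebra.IsIntegral.isIntegral c)) ?_
  rw [sub_eq_zero.1 h]
  have := congrArg S.emb (minpoly.aeval ℚ_[p] c)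
  rwa [map_zero, aeval_def, hom_eval₂] at this

lemma exists_next_isBestApprox (hα : IsTranscOver (qpHomC p S) α) {s : Qpbar p}
    (hs : IsBestApprox α s) :
    ∃ t : Qpbar p, IsBestApprox α t ∧ degOf p s < degOf p t ∧
      S.vC.v (α - S.emb s) < S.vC.v (α - S.emb t) := by
  classical
  have hex : ∃ d : ℕ, ∃ c : Qpbar p, degOf p c = d ∧
      S.vC.v (α - S.emb s) < S.vC.v (α - S.emb c) := by
    obtain ⟨q, hq⟩ := AddVal.exists_v_eq_coe (w := S.vC) (sub_emb_ne_zero hα s)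
    obtain ⟨c, hc⟩ := exists_degOf_lt_v_sub (α := α) q
    exact ⟨_, c, rfl, hq ▸ hc⟩
  obtain ⟨c, hcd, hc⟩ := Nat.find_spec hex
  have hmin : ∀ c' : Qpbar p, degOf p c' < Nat.find hex →
      S.vC.v (α - S.emb c') ≤ S.vC.v (α - S.emb s) := fun c' hc' =>
    not_lt.1 fun h => Nat.find_min hex hc' ⟨c', rfl, h⟩
  obtain ⟨t, ht, hmax⟩ := exists_best_approx hα (d := Nat.find hex) (hcd ▸ degOf_pos c)
  have hst : S.vC.v (α - S.emb s) < S.vC.v (α - S.emb t) := hc.trans_le (hmax c hcd.le)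
  have htd : degOf p t = Nat.find hex :=
    ht.antisymm (not_lt.1 fun h => (hmin t h).not_gt hst)
  exact ⟨t, ⟨fun c' hc' => hmax c' (hc'.trans ht),
    fun c' hc' => (hmin c' (htd ▸ hc')).trans_lt hst⟩,
    not_le.1 fun h => (hs.1 t h).not_gt hst, hst⟩

lemma exists_isStacked (hα : IsTranscOver (qpHomC p S) α) :
    ∃ s : ℕ → Qpbar p, IsStacked p S.toPadicSetup s ∧ S.vbar.IsCauchySeq s ∧
      S.vC.TendsToVal (fun n => S.emb (s n)) α := by
  obtain ⟨s₀, hs₀, hbest⟩ := exists_isBestApprox_degOf_eq_one hα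
  choose! next hnext using fun (s : Qpbar p) (hs : IsBestApprox α s) =>
    exists_next_isBestApprox hα hs
  let s : ℕ → Qpbar p := fun n => Nat.rec s₀ (fun _ x => next x) n
  have hb : ∀ n, IsBestApprox α (s n) := fun n =>
    Nat.rec hbest (fun n ih => (hnext _ ih).1) n
  have hdeg : ∀ n, degOf p (s n) < degOf p (s (n + 1)) := fun n => (hnext _ (hb n)).2.1
  have hval : ∀ n, S.vC.v (α - S.emb (s n)) < S.vC.v (α - S.emb (s (n + 1))) :=
    fun n => (hnext _ (hb n)).2.2
  have hlim : S.vC.TendsToVal (fun n => S.emb (s n)) α := by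
    intro γ
    obtain ⟨c, hc⟩ := exists_degOf_lt_v_sub (α := α) γ
    refine ⟨degOf p c, fun n hn => ?_⟩
    rw [AddVal.v_sub_swap]
    exact hc.trans_le ((hb n).1 c (hn.trans ((strictMono_nat_of_lt_succ hdeg).id_le n)))
  refine ⟨s, ⟨exists_eq_algebraMap_of_degOf_le_one hs₀.le, hdeg, fun n c hc => ?_⟩, ?_, hlim⟩
  · rw [← S.vC_emb, ← S.vC_emb, map_sub, map_sub, ← sub_sub_sub_cancel_left (S.emb c) (S.emb (s n)) α,
      ← sub_sub_sub_cancel_left (S.emb (s n)) (S.emb (s (n + 1))) α,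
      AddVal.v_sub_eq_of_lt_left ((hb n).2 c hc),
      AddVal.v_sub_eq_of_lt_left (hval n)]
    exact (hb n).2 c hc
  · intro γ
    obtain ⟨N, hN⟩ := hlim γ
    refine ⟨N, fun m hm n hn => ?_⟩
    rw [← S.vC_emb, map_sub, ← sub_sub_sub_cancel_right _ _ α]
    exact AddVal.lt_v_sub (hN m hm) (hN n hn)

end Approximation

section Evaluation

variable {p} {S : CpSetup p} {α : S.Cp}

lemma eval₂_denom_ne_zero_of_transc (hα : IsTranscOver (qpHomC p S) α) (φ : RatFunc ℚ_[p]) :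
    φ.denom.eval₂ (qpHomC p S) α ≠ 0 :=
  hα _ φ.denom_ne_zero

/-- Evaluation of rational functions at a transcendental element, as a ring homomorphism. -/
def evalHom (hα : IsTranscOver (qpHomC p S) α) : RatFunc ℚ_[p] →+* S.Cp where
  toFun := RatFunc.eval (qpHomC p S) α
  map_zero' := RatFunc.eval_zero _ _
  map_one' := RatFunc.eval_one _ _
  map_add' φ ψ := RatFunc.eval_add _ _ (eval₂_denom_ne_zero_of_transc hα φ)
    (eval₂_denom_ne_zero_of_transc hα ψ)
  map_mul' φ ψ := RatFunc.eval_mul _ _ (eval₂_denom_ne_zero_of_transc hα φ)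
    (eval₂_denom_ne_zero_of_transc hα ψ)

lemma evalHom_algebraMap (hα : IsTranscOver (qpHomC p S) α) (f : ℚ_[p][X]) :
    evalHom hα (algebraMap _ _ f) = f.eval₂ (qpHomC p S) α :=
  RatFunc.eval_algebraMap _ _ f

lemma inQpAlpha_iff (hα : IsTranscOver (qpHomC p S) α) (x : S.Cp) :
    InQpAlpha p S α x ↔ x ∈ (evalHom hα).fieldRange := by
  rw [RingHom.mem_fieldRange]
  constructor
  · rintro ⟨f, g, -, rfl⟩
    exact ⟨algebraMap _ _ f / algebraMap _ _ g, by
      rw [map_div₀, evalHom_algebraMap, evalHom_algebraMap]⟩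
  · rintro ⟨φ, rfl⟩
    exact ⟨φ.num, φ.denom, eval₂_denom_ne_zero_of_transc hα φ, rfl⟩

lemma qpHomC_mem_fieldRange (hα : IsTranscOver (qpHomC p S) α) (c : ℚ_[p]) :
    qpHomC p S c ∈ (evalHom hα).fieldRange :=
  ⟨RatFunc.C c, RatFunc.eval_C _ _⟩

lemma self_mem_fieldRange (hα : IsTranscOver (qpHomC p S) α) : α ∈ (evalHom hα).fieldRange :=
  ⟨RatFunc.X, RatFunc.eval_X _ _⟩

end Evaluation

section FiniteExtension

variable {p} {S : CpSetup p} {F : Subfield S.Cp}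

/-- If `F` has values in `e⁻¹ℤ` and finite residue field, then its integers are finite modulo
elements of valuation at least `k / e`. -/
lemma exists_finite_approx {e : ℕ} (he : 0 < e)
    (hval : ∀ x ∈ F, ∀ γ : ℚ, S.vC.v x = γ → ∃ k : ℤ, (e : ℚ) * γ = k)
    {T : Set S.Cp} (hT : T.Finite) (hTF : T ⊆ F)
    (hres : ∀ x ∈ F, 0 ≤ S.vC.v x → ∃ a ∈ T, 0 < S.vC.v (x - a)) (k : ℕ) :
    ∃ B : Set S.Cp, B.Finite ∧ B ⊆ F ∧
      ∀ x ∈ F, 0 ≤ S.vC.v x → ∃ b ∈ B, ((k / e : ℚ) : WithTop ℚ) ≤ S.vC.v (x - b) := by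
  have he' : (0 : ℚ) < e := by exact_mod_cast he
  have step : ∀ z ∈ F, ∀ k : ℕ, ((k / e : ℚ) : WithTop ℚ) < S.vC.v z →
      (((k + 1 : ℕ) / e : ℚ) : WithTop ℚ) ≤ S.vC.v z := by
    intro z hz k hk
    cases hv : S.vC.v z with
    | top => exact le_top
    | coe q =>
      obtain ⟨m, hm⟩ := hval z hz q hv
      rw [hv, WithTop.coe_lt_coe, div_lt_iff₀ he', mul_comm, hm] at hk
      rw [WithTop.coe_le_coe, div_le_iff₀ he', mul_comm, hm]
      have : (k : ℤ) < m := by exact_mod_cast hk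
      exact_mod_cast Int.add_one_le_of_lt this
  induction k with
  | zero => exact ⟨{0}, Set.finite_singleton 0, by simp, fun x _ hx => ⟨0, rfl, by simpa using hx⟩⟩
  | succ k ih =>
    obtain ⟨B, hB, hBF, hB'⟩ := ih
    by_cases hπ : ∃ π ∈ F, S.vC.v π = ((k / e : ℚ) : WithTop ℚ)
    · obtain ⟨π, hπF, hπ⟩ := hπ
      have hπ0 : π ≠ 0 := by
        rintro rfl
        simp [AddVal.v_zero] at hπ
      refine ⟨Set.image2 (fun b t => b + π * t) B T, hB.image2 _ hT, ?_, fun x hx hx0 => ?_⟩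
      · rintro _ ⟨b, hb, t, ht, rfl⟩
        exact add_mem (hBF hb) (mul_mem hπF (hTF ht))
      · obtain ⟨b, hb, hxb⟩ := hB' x hx hx0
        have hzF : x - b ∈ F := sub_mem hx (hBF hb)
        obtain ⟨t, ht, hlt⟩ := hres (π⁻¹ * (x - b)) (mul_mem (inv_mem hπF) hzF) (by
          rw [S.vC.v_mul, AddVal.v_inv hπ]
          refine le_trans ?_ (add_le_add le_rfl hxb)
          rw [← WithTop.coe_add, neg_add_cancel, WithTop.coe_zero])
        refine ⟨_, ⟨b, hb, t, ht, rfl⟩, ?_⟩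
        have heq : x - (b + π * t) = π * (π⁻¹ * (x - b) - t) := by
          field_simp
          ring
        refine step _ (sub_mem hx (add_mem (hBF hb) (mul_mem hπF (hTF ht)))) k ?_
        rw [heq, S.vC.v_mul, hπ]
        cases hv : S.vC.v (π⁻¹ * (x - b) - t) with
        | top => simp
        | coe q =>
          rw [hv] at hlt
          have hq : 0 < q := by exact_mod_cast hlt
          rw [← WithTop.coe_add, WithTop.coe_lt_coe]
          linarith
    · refine ⟨B, hB, hBF, fun x hx hx0 => ?_⟩
      obtain ⟨b, hb, hxb⟩ := hB' x hx hx0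
      have hzF : x - b ∈ F := sub_mem hx (hBF hb)
      exact ⟨b, hb, step _ hzF k (hxb.lt_of_ne fun h => hπ ⟨_, hzF, h.symm⟩)⟩

lemma v_qpHomC_prime_pow (m : ℤ) :
    S.vC.v (qpHomC p S ((p : ℚ_[p]) ^ m)) = ((m : ℚ) : WithTop ℚ) := by
  have hp : (p : ℚ_[p]) ≠ 0 := by exact_mod_cast (Fact.out : p.Prime).ne_zero
  rw [v_qpHomC S (zpow_ne_zero m hp), Padic.valuation_zpow, Padic.valuation_p, mul_one]

/-- If the integers of `F` are finite modulo `p`, then they are `ℤ_p`-linear combinations of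
finitely many elements. -/
lemma exists_eq_sum_of_finite_mod_prime (hF : ∀ c : ℚ_[p], qpHomC p S c ∈ F)
    (B : Finset S.Cp) (hBF : ∀ b ∈ B, b ∈ F)
    (hB : ∀ x ∈ F, 0 ≤ S.vC.v x → ∃ b ∈ B, 1 ≤ S.vC.v (x - b))
    {x : S.Cp} (hx : x ∈ F) (hx0 : 0 ≤ S.vC.v x) :
    ∃ a : B → ℚ_[p], x = ∑ b, qpHomC p S (a b) * b := by
  classical
  have hp : (p : ℚ_[p]) ≠ 0 := by exact_mod_cast (Fact.out : p.Prime).ne_zero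
  have hπ1 : S.vC.v (qpHomC p S p) = 1 := by
    simpa using v_qpHomC_prime_pow (S := S) 1
  have hπ0 : qpHomC p S p ≠ 0 := (_root_.map_ne_zero _).2 hp
  have approx : ∀ n : ℕ, ∀ x ∈ F, 0 ≤ S.vC.v x → ∃ a : B → ℚ_[p], (∀ b, ‖a b‖ ≤ 1) ∧
      (n : WithTop ℚ) ≤ S.vC.v (x - ∑ b, qpHomC p S (a b) * b) := by
    intro n
    induction n with
    | zero => exact fun x _ hx0 => ⟨0, by simp, by simpa using hx0⟩
    | succ n ih =>
      intro x hx hx0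
      obtain ⟨b₀, hb₀, hxb⟩ := hB x hx hx0
      have hy0 : 0 ≤ S.vC.v ((qpHomC p S p)⁻¹ * (x - b₀)) := by
        rw [S.vC.v_mul, AddVal.v_inv (q := 1) (by simpa using hπ1)]
        refine le_trans ?_ (add_le_add le_rfl hxb)
        rw [← WithTop.coe_one, ← WithTop.coe_add, neg_add_cancel, WithTop.coe_zero]
      obtain ⟨a, ha, hle⟩ := ih _
        (mul_mem (inv_mem (hF p)) (sub_mem hx (hBF b₀ hb₀))) hy0
      refine ⟨fun b => (if b = ⟨b₀, hb₀⟩ then 1 else 0) + p * a b, fun b => ?_, ?_⟩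
      · refine (Padic.nonarchimedean _ _).trans (max_le ?_ ?_)
        · split_ifs <;> simp
        · rw [norm_mul]
          exact mul_le_one₀ (Padic.norm_p_lt_one).le (norm_nonneg _) (ha b)
      · have heq : x - ∑ b : B,
            qpHomC p S ((if b = ⟨b₀, hb₀⟩ then 1 else 0) + p * a b) * b =
            qpHomC p S p * ((qpHomC p S p)⁻¹ * (x - b₀) - ∑ b, qpHomC p S (a b) * b) := by
          rw [mul_sub, mul_inv_cancel_left₀ hπ0, Finset.mul_sum]
          simp only [map_add, map_mul, add_mul, Finset.sum_add_distrib, apply_ite (qpHomC p S),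
            map_one, map_zero, ite_mul, one_mul, zero_mul, Finset.sum_ite_eq', Finset.mem_univ,
            if_true, mul_assoc]
          ring
        rw [heq, S.vC.v_mul, hπ1, Nat.cast_succ, add_comm]
        exact add_le_add le_rfl hle
  obtain ⟨a, -, ha⟩ := exists_eq_sum_of_forall_approx S
    (isCompact_closedBall (0 : B → ℚ_[p]) 1) (fun b => (b : S.Cp)) x (fun n => by
      obtain ⟨a, ha, hle⟩ := approx (n + 1) x hx hx0
      refine ⟨a, ?_, lt_of_lt_of_le ?_ hle⟩
      · rw [mem_closedBall_zero_iff]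
        exact (pi_norm_le_iff_of_nonneg zero_le_one).2 ha
      · exact_mod_cast Nat.lt_succ_self n)
  exact ⟨a, ha⟩

/-- A subfield of `ℂ_p` containing `ℚ_p` whose integers are finite modulo `p` contains no
transcendental element. -/
lemma not_isTranscOver_of_finite_mod_prime (hF : ∀ c : ℚ_[p], qpHomC p S c ∈ F)
    (B : Finset S.Cp) (hBF : ∀ b ∈ B, b ∈ F)
    (hB : ∀ x ∈ F, 0 ≤ S.vC.v x → ∃ b ∈ B, 1 ≤ S.vC.v (x - b))
    {α : S.Cp} (hαF : α ∈ F) : ¬ IsTranscOver (qpHomC p S) α := by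
  intro hα
  let _ : Algebra ℚ_[p] S.Cp := (qpHomC p S).toAlgebra
  have hp : (p : ℚ_[p]) ≠ 0 := by exact_mod_cast (Fact.out : p.Prime).ne_zero
  have hspan : ∀ x ∈ F, x ∈ Submodule.span ℚ_[p] (B : Set S.Cp) := by
    intro x hx
    obtain ⟨m, hm⟩ : ∃ m : ℤ, 0 ≤ S.vC.v (qpHomC p S ((p : ℚ_[p]) ^ m) * x) := by
      rcases eq_or_ne x 0 with rfl | h0
      · exact ⟨0, by simp [AddVal.v_zero]⟩
      · obtain ⟨q, hq⟩ := AddVal.exists_v_eq_coe (w := S.vC) h0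
        obtain ⟨m, hm⟩ := exists_int_gt (-q)
        refine ⟨m, ?_⟩
        rw [S.vC.v_mul, v_qpHomC_prime_pow, hq]
        have : 0 ≤ (m : ℚ) + q := by linarith
        exact_mod_cast this
    obtain ⟨a, ha⟩ := exists_eq_sum_of_finite_mod_prime hF B hBF hB (mul_mem (hF _) hx) hm
    have hmem : (p : ℚ_[p]) ^ m • x ∈ Submodule.span ℚ_[p] (B : Set S.Cp) := by
      rw [Algebra.smul_def]
      refine ha ▸ Submodule.sum_mem _ fun b _ => ?_
      exact (Algebra.smul_def (a b) (b : S.Cp)) ▸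
        Submodule.smul_mem _ _ (Submodule.subset_span b.2)
    exact ((Submodule.span ℚ_[p] (B : Set S.Cp)).smul_mem_iff (zpow_ne_zero m hp)).1 hmem
  have hle : Subalgebra.toSubmodule (Algebra.adjoin ℚ_[p] {α}) ≤
      Submodule.span ℚ_[p] (B : Set S.Cp) := by
    intro x hx
    refine hspan x ?_
    let E : Subalgebra ℚ_[p] S.Cp := { F.toSubsemiring with algebraMap_mem' := hF }
    have : Algebra.adjoin ℚ_[p] {α} ≤ E := Algebra.adjoin_le (Set.singleton_subset_iff.2 hαF)
    exact this hx
  have : FiniteDimensional ℚ_[p] (Submodule.span ℚ_[p] (B : Set S.Cp)) :=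
    FiniteDimensional.span_finset _ _
  have hfin : FiniteDimensional ℚ_[p] (Subalgebra.toSubmodule (Algebra.adjoin ℚ_[p] {α})) :=
    Submodule.finiteDimensional_of_le hle
  have hint : IsIntegral ℚ_[p] α := IsIntegral.of_mem_of_fg _ (Module.Finite.iff_fg.1 hfin) α
    (Algebra.self_mem_adjoin_singleton _ α)
  obtain ⟨f, hf, hf0⟩ := hint
  exact hα f hf.ne_zero hf0

lemma not_finite_of_isTranscOver {α : S.Cp} (hα : IsTranscOver (qpHomC p S) α) :
    ¬ (HasFiniteRamification (valSetCp p S α) ∧ ResFieldFiniteCp p S α) := by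
  rintro ⟨⟨e, he, hram⟩, T, hT⟩
  set F := (evalHom hα).fieldRange
  have hFT : ∀ a : S.Cp, ∃ y ∈ F, ∀ x ∈ F, 0 < S.vC.v (x - a) → 0 < S.vC.v (x - y) := by
    intro a
    by_cases h : ∃ y ∈ F, 0 < S.vC.v (y - a)
    · obtain ⟨y, hy, hya⟩ := h
      exact ⟨y, hy, fun x _ hx => sub_sub_sub_cancel_right x y a ▸ AddVal.lt_v_sub hx hya⟩
    · exact ⟨0, zero_mem _, fun x hx hxa => (h ⟨x, hx, hxa⟩).elim⟩
  choose r hrF hr using hFT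
  obtain ⟨B, hBfin, hBF, hB⟩ := exists_finite_approx (F := F) he
    (fun x hx γ hγ => hram γ ⟨x, (inQpAlpha_iff hα x).2 hx, hγ⟩)
    (T.finite_toSet.image r) (by rintro _ ⟨a, -, rfl⟩; exact hrF a)
    (fun x hx hx0 => by
      obtain ⟨a, ha, hxa⟩ := hT x ((inQpAlpha_iff hα x).2 hx) hx0
      exact ⟨r a, ⟨a, ha, rfl⟩, hr a x hx hxa⟩) e
  have he' : (e : ℚ) ≠ 0 := by exact_mod_cast he.ne'
  rw [div_self he', WithTop.coe_one] at hB
  exact not_isTranscOver_of_finite_mod_prime (qpHomC_mem_fieldRange hα) hBfin.toFinset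
    (fun b hb => hBF (hBfin.mem_toFinset.1 hb))
    (fun x hx hx0 => by simpa using hB x hx hx0) (self_mem_fieldRange hα) hα

end FiniteExtension

/-- Let `α ∈ ℂ_p` be transcendental (over `ℚ_p`).  Then:
(1) there is a stacked Cauchy sequence `E ⊆ Q̄_p` converging to `α`;
(2) the valued fields `(ℚ_p(X), ℤ_{p,α})` and `(ℚ_p(α), O_{p,α})` are isomorphic via the
evaluation map `φ ↦ φ(α)` (it is an injective ring homomorphism with image `ℚ_p(α)`,
matching `ℤ_{p,α}` with `O_{p,α}`);
(3) consequently `e(ℤ_{p,α}|ℤ_p) = e_α` and `f(ℤ_{p,α}|ℤ_p) = f_α` (the value group of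
`ℤ_{p,α}` is `Γ_α` and its residue field is `k_α`), and `e_α · f_α = ∞`. -/
theorem stmt_7 (p : ℕ) [Fact p.Prime] (S : CpSetup p) (α : S.Cp)
    (hα : IsTranscOver (qpHomC p S) α) :
    -- (1)
    (∃ s : ℕ → Qpbar p, IsStacked p S.toPadicSetup s ∧ S.vbar.IsCauchySeq s ∧
      S.vC.TendsToVal (fun n => S.emb (s n)) α) ∧
    -- (2)
    ((∀ φ ψ : RatFunc ℚ_[p],
        RatFunc.eval (qpHomC p S) α (φ + ψ) =
          RatFunc.eval (qpHomC p S) α φ + RatFunc.eval (qpHomC p S) α ψ) ∧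
      (∀ φ ψ : RatFunc ℚ_[p],
        RatFunc.eval (qpHomC p S) α (φ * ψ) =
          RatFunc.eval (qpHomC p S) α φ * RatFunc.eval (qpHomC p S) α ψ) ∧
      Function.Injective (fun φ : RatFunc ℚ_[p] => RatFunc.eval (qpHomC p S) α φ) ∧
      (∀ x : S.Cp, InQpAlpha p S α x ↔ ∃ φ : RatFunc ℚ_[p], RatFunc.eval (qpHomC p S) α φ = x) ∧
      (∀ φ : RatFunc ℚ_[p], φ ∈ Zpa p S α ↔ 0 ≤ S.vC.v (RatFunc.eval (qpHomC p S) α φ))) ∧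
    -- (3): the value group of `ℤ_{p,α}` is `Γ_α` …
    ({γ : ℚ | ∃ φ : RatFunc ℚ_[p], S.vC.v (RatFunc.eval (qpHomC p S) α φ) = (γ : WithTop ℚ)}
        = valSetCp p S α) ∧
    -- … its residue field is `k_α` …
    (∀ x : S.Cp, InQpAlpha p S α x → 0 ≤ S.vC.v x →
      ∃ φ ∈ Zpa p S α, 0 < S.vC.v (RatFunc.eval (qpHomC p S) α φ - x)) ∧
    -- … and `e_α · f_α = ∞`
    ¬ (HasFiniteRamification (valSetCp p S α) ∧ ResFieldFiniteCp p S α) := by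
  have hrange : ∀ x : S.Cp, InQpAlpha p S α x ↔
      ∃ φ : RatFunc ℚ_[p], RatFunc.eval (qpHomC p S) α φ = x := inQpAlpha_iff hα
  have hmem : ∀ φ : RatFunc ℚ_[p],
      φ ∈ Zpa p S α ↔ 0 ≤ S.vC.v (RatFunc.eval (qpHomC p S) α φ) := fun φ =>
    and_iff_right (eval₂_denom_ne_zero_of_transc hα φ)
  refine ⟨exists_isStacked hα, ⟨map_add (evalHom hα), map_mul (evalHom hα),
    (evalHom hα).injective, hrange, hmem⟩, ?_, fun x hx hx0 => ?_,
    not_finite_of_isTranscOver hα⟩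
  · ext γ
    constructor
    · rintro ⟨φ, hφ⟩
      exact ⟨_, (hrange _).2 ⟨φ, rfl⟩, hφ⟩
    · rintro ⟨x, hx, hxγ⟩
      obtain ⟨φ, rfl⟩ := (hrange x).1 hx
      exact ⟨φ, hxγ⟩
  · obtain ⟨φ, rfl⟩ := (hrange x).1 hx
    exact ⟨φ, (hmem φ).2 hx0, by simp [AddVal.v_zero]⟩

end
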